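/- Let T₁ and T₂ be symmetric complex a×a matrices with negative definite real parts. Then (2π)^{−a} ∫_{[0,2π]^{2a}} θ[T₁; z, ζ] · conj(θ[T₂; z, ζ]) dz dζ = ∫_{ℝᵃ} exp{½ zᵗ (T₁ + conj(T₂)) z} dz, and there exists μ ∈ ℂ with μ² = det(−T₁ − conj(T₂))⁻¹ such that this common value equals (2π)^{a/2} μ. -/

import Mathlib

open Matrix MeasureTheory Real

noncomputable section

/-- Complexification of a real vector. -/
def cv {ι : Type*} (x : ι → ℝ) : ι → ℂ := fun i => (x i : ℂ)

/-- The theta-function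
`θ[T; z, ζ] = Σ_{k∈ℤᵃ} exp{½ (z + 2πk)ᵗ T (z + 2πk)} e^{i k·ζ}`. -/
def theta {a : ℕ} (T : Matrix (Fin a) (Fin a) ℂ) (z ζ : Fin a → ℝ) : ℂ :=
  ∑' k : Fin a → ℤ,
    Complex.exp
      ((1 / 2 : ℂ) * dotProduct (cv fun i => z i + 2 * π * k i)
          (T.mulVec (cv fun i => z i + 2 * π * k i))
        + Complex.I * ∑ i, (k i : ℂ) * (ζ i : ℂ))


lemma sym_diag {a : ℕ} (S : Matrix (Fin a) (Fin a) ℝ) (hS : S.IsHermitian) :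
    ∃ U : Matrix (Fin a) (Fin a) ℝ, Uᵀ * U = 1 ∧ Uᵀ * S * U = diagonal hS.eigenvalues := by
  refine ⟨hS.eigenvectorUnitary, ?_, ?_⟩
  · have := Unitary.coe_star_mul_self hS.eigenvectorUnitary
    rwa [star_eq_conjTranspose, conjTranspose_eq_transpose_of_trivial] at this
  · have := hS.conjStarAlgAut_star_eigenvectorUnitary
    rw [Unitary.conjStarAlgAut_apply] at this
    simp only [star_star, Unitary.coe_star] at this
    rw [star_eq_conjTranspose, conjTranspose_eq_transpose_of_trivial] at this
    exact this

lemma sim_diag {a : ℕ} (A B : Matrix (Fin a) (Fin a) ℝ) (hA : A.PosDef) (hB : Bᵀ = B) :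
    ∃ (P : Matrix (Fin a) (Fin a) ℝ) (d : Fin a → ℝ), P.det ≠ 0 ∧ Pᵀ * A * P = 1 ∧
      Pᵀ * B * P = diagonal d := by
  obtain ⟨U, hU, hUA⟩ := sym_diag A hA.1
  set l := hA.1.eigenvalues
  have hl : ∀ i, 0 < l i := hA.eigenvalues_pos
  set E : Matrix (Fin a) (Fin a) ℝ := diagonal fun i => (√(l i))⁻¹ with hE
  have hQ : (U * E)ᵀ * A * (U * E) = 1 := by
    have : (U * E)ᵀ * A * (U * E) = Eᵀ * (Uᵀ * A * U) * E := by
      simp only [transpose_mul, Matrix.mul_assoc]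
    rw [this, hUA, hE, diagonal_transpose, diagonal_mul_diagonal, diagonal_mul_diagonal,
      ← diagonal_one]
    congr 1
    ext i
    have h := Real.mul_self_sqrt (hl i).le
    have h0 : √(l i) ≠ 0 := (Real.sqrt_pos.2 (hl i)).ne'
    field_simp
    nlinarith
  have hS : ((U * E)ᵀ * B * (U * E)).IsHermitian := by
    rw [IsHermitian, conjTranspose_eq_transpose_of_trivial]
    simp only [transpose_mul, transpose_transpose, hB, Matrix.mul_assoc]
  obtain ⟨V, hV, hVB⟩ := sym_diag _ hS
  have h1 : (U * E * V)ᵀ * A * (U * E * V) = 1 := by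
    have : (U * E * V)ᵀ * A * (U * E * V) = Vᵀ * ((U * E)ᵀ * A * (U * E)) * V := by
      simp only [transpose_mul, Matrix.mul_assoc]
    rw [this, hQ, Matrix.mul_one, hV]
  refine ⟨U * E * V, hS.eigenvalues, ?_, h1, ?_⟩
  · intro h
    have := congrArg det h1
    rw [det_mul, h] at this
    simp at this
  · rw [← hVB]
    simp only [transpose_mul, Matrix.mul_assoc]

lemma cv_mulVec {a : ℕ} (P : Matrix (Fin a) (Fin a) ℝ) (y : Fin a → ℝ) :
    cv (P *ᵥ y) = (P.map Complex.ofReal) *ᵥ cv y := by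
  ext i
  simp [cv, mulVec, dotProduct]

lemma gauss {a : ℕ} (N : Matrix (Fin a) (Fin a) ℂ) (hs : Nᵀ = N)
    (hN : (-(N.map Complex.re)).PosDef) :
    ∃ μ : ℂ, μ ^ 2 = ((-N).det)⁻¹ ∧
      (∫ z : Fin a → ℝ, Complex.exp ((1 / 2 : ℂ) * dotProduct (cv z) (N.mulVec (cv z))))
        = (((2 * π) ^ ((a : ℝ) / 2) : ℝ) : ℂ) * μ := by
  have hB : (-(N.map Complex.im))ᵀ = -(N.map Complex.im) := by
    rw [transpose_neg, ← transpose_map, hs]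
  obtain ⟨P, d, hP, hPA, hPB⟩ := sim_diag _ _ hN hB
  set PC : Matrix (Fin a) (Fin a) ℂ := P.map Complex.ofReal with hPC
  have hmap : ∀ X Y : Matrix (Fin a) (Fin a) ℝ,
      (X * Y).map Complex.ofReal = X.map Complex.ofReal * Y.map Complex.ofReal := fun X Y =>
    Matrix.map_mul (f := Complex.ofRealHom)
  have hdec : -N = (-(N.map Complex.re)).map Complex.ofReal
      + Complex.I • (-(N.map Complex.im)).map Complex.ofReal := by
    ext i j
    apply Complex.ext <;> simp
  have hD : PCᵀ * (-N) * PC = diagonal fun i => 1 + Complex.I * (d i : ℂ) := by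
    have e1 := congrArg (fun M => Matrix.map M Complex.ofReal) hPA
    have e2 := congrArg (fun M => Matrix.map M Complex.ofReal) hPB
    simp only [hmap] at e1 e2
    rw [hdec, Matrix.mul_add, Matrix.add_mul, Matrix.mul_smul, Matrix.smul_mul, hPC,
      ← transpose_map, e1, e2]
    ext i j
    by_cases h : i = j
    · subst h; simp
    · simp [h]
  have hdetPC : PC.det = (P.det : ℂ) := (RingHom.map_det Complex.ofRealHom P).symm
  have hPc : (P.det : ℂ) ≠ 0 := by exact_mod_cast hP
  have hdet : (P.det : ℂ) ^ 2 * (-N).det = ∏ i, (1 + Complex.I * (d i : ℂ)) := by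
    have := congrArg det hD
    rw [det_mul, det_mul, det_transpose, hdetPC, det_diagonal] at this
    rw [← this]; ring
  have hint : ∫ z : Fin a → ℝ, Complex.exp ((1 / 2 : ℂ) * dotProduct (cv z) (N.mulVec (cv z)))
      = |P.det| * ∏ i, ((π : ℂ) / ((1 + Complex.I * (d i : ℂ)) / 2)) ^ (1 / 2 : ℂ) := by
    set f : (Fin a → ℝ) → ℂ := fun z =>
      Complex.exp ((1 / 2 : ℂ) * dotProduct (cv z) (N.mulVec (cv z))) with hf
    have hfc : Continuous f := by
      simp only [hf, dotProduct, mulVec, cv]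
      fun_prop
    have h1 := map_matrix_volume_pi_eq_smul_volume_pi hP
    have h2 : ∫ y : Fin a → ℝ, f (toLin' P y) = |P.det|⁻¹ * ∫ z, f z := by
      rw [← integral_map (μ := volume) (φ := toLin' P) (f := f)
        (LinearMap.continuous_of_finiteDimensional _).measurable.aemeasurable
        hfc.aestronglyMeasurable, h1, integral_smul_measure,
        ENNReal.toReal_ofReal (abs_nonneg _), abs_inv]
      simp
    have h3 : ∀ y : Fin a → ℝ, f (toLin' P y)
        = ∏ i, Complex.exp (-((1 + Complex.I * (d i : ℂ)) / 2) * (y i : ℂ) ^ 2) := by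
      intro y
      rw [← Complex.exp_sum, hf]
      simp only [toLin'_apply]
      congr 1
      have : cv (P *ᵥ y) ⬝ᵥ N *ᵥ cv (P *ᵥ y) = - (cv y ⬝ᵥ (PCᵀ * (-N) * PC) *ᵥ cv y) := by
        rw [cv_mulVec, ← hPC, ← mulVec_mulVec, ← mulVec_mulVec, neg_mulVec, mulVec_neg,
          dotProduct_neg, neg_neg, dotProduct_mulVec (cv y), vecMul_transpose]
      rw [this, hD]
      simp only [mulVec_diagonal, dotProduct, cv]
      rw [mul_neg, Finset.mul_sum, ← Finset.sum_neg_distrib]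
      refine Finset.sum_congr rfl fun i _ => ?_
      ring
    have h4 : ∫ y : Fin a → ℝ, f (toLin' P y)
        = ∏ i, ((π : ℂ) / ((1 + Complex.I * (d i : ℂ)) / 2)) ^ (1 / 2 : ℂ) := by
      simp_rw [h3]
      rw [integral_fintype_prod_volume_eq_prod (fun i (x : ℝ) =>
        Complex.exp (-((1 + Complex.I * (d i : ℂ)) / 2) * (x : ℂ) ^ 2))]
      refine Finset.prod_congr rfl fun i _ => ?_
      rw [integral_gaussian_complex]
      simp
    rw [← h4, h2]
    have : ((|P.det| : ℝ) : ℂ) ≠ 0 := by exact_mod_cast abs_ne_zero.2 hP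
    push_cast
    field_simp
  have hpi : (((2 * π) ^ ((a : ℝ) / 2) : ℝ) : ℂ) ≠ 0 := by
    exact_mod_cast (Real.rpow_pos_of_pos (by positivity) _).ne'
  have hpi2 : (((2 * π) ^ ((a : ℝ) / 2) : ℝ) : ℂ) ^ 2 = (2 * π : ℂ) ^ a := by
    rw [← Complex.ofReal_pow, ← Real.rpow_natCast, ← Real.rpow_mul (by positivity)]
    rw [show (a : ℝ) / 2 * (2 : ℕ) = a by push_cast; ring, Real.rpow_natCast]
    push_cast; rfl
  refine ⟨(((2 * π) ^ ((a : ℝ) / 2) : ℝ) : ℂ)⁻¹ * (∫ z : Fin a → ℝ,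
    Complex.exp ((1 / 2 : ℂ) * dotProduct (cv z) (N.mulVec (cv z)))), ?_, ?_⟩
  · rw [hint, mul_pow, mul_pow, inv_pow, hpi2, ← Finset.prod_pow]
    have : ∀ i, (((π : ℂ) / ((1 + Complex.I * (d i : ℂ)) / 2)) ^ (1 / 2 : ℂ)) ^ 2
        = (2 * π) * (1 + Complex.I * (d i : ℂ))⁻¹ := by
      intro i
      rw [← Complex.cpow_nat_mul]
      simp
      field_simp
    simp_rw [this]
    rw [Finset.prod_mul_distrib, Finset.prod_inv_distrib, ← hdet]
    have h5 : ((|P.det| : ℝ) : ℂ) ^ 2 = (P.det : ℂ) ^ 2 := by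
      rw [← Complex.ofReal_pow, sq_abs]; push_cast; rfl
    rw [h5, Finset.prod_const, Finset.card_univ, Fintype.card_fin, mul_inv]
    have : (2 * π : ℂ) ^ a ≠ 0 := by
      rw [← hpi2]; exact pow_ne_zero _ hpi
    field_simp
  · rw [mul_inv_cancel_left₀ hpi]

def qf {a : ℕ} (T : Matrix (Fin a) (Fin a) ℂ) (w : Fin a → ℝ) : ℂ :=
  Complex.exp ((1 / 2 : ℂ) * dotProduct (cv w) (T.mulVec (cv w)))

def ef {a : ℕ} (k : Fin a → ℤ) (ζ : Fin a → ℝ) : ℂ :=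
  Complex.exp (Complex.I * ∑ i, (k i : ℂ) * (ζ i : ℂ))

def sh {a : ℕ} (z : Fin a → ℝ) (k : Fin a → ℤ) : Fin a → ℝ := fun i => z i + 2 * π * k i

lemma theta_eq {a : ℕ} (T : Matrix (Fin a) (Fin a) ℂ) (z ζ : Fin a → ℝ) :
    theta T z ζ = ∑' k, qf T (sh z k) * ef k ζ := by
  simp only [theta, qf, ef, Complex.exp_add]
  rfl

lemma qf_cont {a : ℕ} (T : Matrix (Fin a) (Fin a) ℂ) : Continuous (qf T) := by
  unfold qf cv
  simp only [dotProduct, mulVec]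
  fun_prop

lemma ef_cont {a : ℕ} (k : Fin a → ℤ) : Continuous (ef k) := by
  unfold ef
  fun_prop

lemma sh_cont {a : ℕ} (k : Fin a → ℤ) : Continuous (fun z => sh z k) := by
  unfold sh
  fun_prop

lemma ef_norm {a : ℕ} (k : Fin a → ℤ) (ζ : Fin a → ℝ) : ‖ef k ζ‖ = 1 := by
  rw [ef, mul_comm]
  have : ∑ i, (k i : ℂ) * (ζ i : ℂ) = ((∑ i, (k i : ℝ) * ζ i : ℝ) : ℂ) := by push_cast; rfl
  rw [this, Complex.norm_exp_ofReal_mul_I]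

lemma coer {a : ℕ} (A : Matrix (Fin a) (Fin a) ℝ) (hA : A.PosDef) :
    ∃ c > 0, ∀ x : Fin a → ℝ, c * ∑ i, x i ^ 2 ≤ x ⬝ᵥ A *ᵥ x := by
  obtain ⟨P, d, hP, hPA, -⟩ := sim_diag A 0 hA (by simp)
  set K := ∑ i, ∑ j, P i j ^ 2 with hK
  have hK0 : 0 ≤ K := by positivity
  refine ⟨1 / (K + 1), by positivity, fun x => ?_⟩
  set y := P⁻¹ *ᵥ x with hy
  have hx : x = P *ᵥ y := by
    rw [hy, mulVec_mulVec, mul_nonsing_inv _ (isUnit_iff_ne_zero.2 hP), one_mulVec]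
  have h1 : x ⬝ᵥ A *ᵥ x = ∑ j, y j ^ 2 := by
    have : x ⬝ᵥ A *ᵥ x = y ⬝ᵥ (Pᵀ * A * P) *ᵥ y := by
      rw [hx, ← mulVec_mulVec, ← mulVec_mulVec, dotProduct_mulVec y, vecMul_transpose]
    rw [this, hPA, one_mulVec]
    simp [dotProduct, sq]
  have h2 : ∑ i, x i ^ 2 ≤ K * ∑ j, y j ^ 2 := by
    rw [hK, Finset.sum_mul]
    refine Finset.sum_le_sum fun i _ => ?_
    rw [hx]
    exact Finset.sum_mul_sq_le_sq_mul_sq Finset.univ (fun j => P i j) y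
  rw [h1, div_mul_eq_mul_div, one_mul, div_le_iff₀ (by positivity)]
  have : 0 ≤ ∑ j, y j ^ 2 := by positivity
  nlinarith

lemma qf_bound {a : ℕ} (T : Matrix (Fin a) (Fin a) ℂ) (hT : (-(T.map Complex.re)).PosDef) :
    ∃ c > 0, ∀ w : Fin a → ℝ, ‖qf T w‖ ≤ rexp (-c * ∑ i, w i ^ 2) := by
  obtain ⟨c, hc, h⟩ := coer _ hT
  refine ⟨c / 2, by positivity, fun w => ?_⟩
  rw [qf, Complex.norm_exp]
  apply Real.exp_le_exp.2
  have h1 := h w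
  have h2 : ((1 / 2 : ℂ) * dotProduct (cv w) (T.mulVec (cv w))).re
      = (1 / 2) * (w ⬝ᵥ (T.map Complex.re) *ᵥ w) := by
    rw [show (1 / 2 : ℂ) = ((1 / 2 : ℝ) : ℂ) by push_cast; rfl, Complex.re_ofReal_mul]
    simp [dotProduct, mulVec, cv]
  rw [h2]
  rw [neg_mulVec, dotProduct_neg] at h1
  linarith

lemma summ_pi (f : ℤ → ℝ) (h0 : ∀ n, 0 ≤ f n) (hf : Summable f) (a : ℕ) :
    Summable fun k : Fin a → ℤ => ∏ i, f (k i) := by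
  induction a with
  | zero => exact Summable.of_finite
  | succ n ih =>
    rw [← (Fin.consEquiv (fun _ : Fin (n + 1) => ℤ)).summable_iff]
    have := Summable.mul_of_nonneg hf ih h0 (fun k => Finset.prod_nonneg fun i _ => h0 _)
    refine this.congr fun p => ?_
    simp [Fin.consEquiv, Fin.prod_univ_succ]

lemma summ_one (c : ℝ) (hc : 0 < c) : Summable fun n : ℤ => rexp (-c * (n : ℝ) ^ 2) := by
  have hN : Summable fun n : ℕ => rexp (-c * (n : ℝ) ^ 2) := by
    have hg : Summable fun n : ℕ => rexp (-c) ^ n :=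
      summable_geometric_of_lt_one (Real.exp_pos _).le (by simpa using hc)
    refine hg.of_nonneg_of_le (fun n => (Real.exp_pos _).le) fun n => ?_
    rw [← Real.exp_nat_mul]
    apply Real.exp_le_exp.2
    have : (n : ℝ) ≤ (n : ℝ) ^ 2 := by exact_mod_cast Nat.le_self_pow two_ne_zero n
    nlinarith
  apply Summable.of_nat_of_neg
  · simpa using hN
  · simpa using hN

lemma qf_unif {a : ℕ} (T : Matrix (Fin a) (Fin a) ℂ) (hT : (-(T.map Complex.re)).PosDef) :
    ∃ u : (Fin a → ℤ) → ℝ, Summable u ∧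
      ∀ k, ∀ z ∈ Set.Icc (0 : Fin a → ℝ) (fun _ => 2 * π), ‖qf T (sh z k)‖ ≤ u k := by
  obtain ⟨c, hc, h⟩ := qf_bound T hT
  have hs := summ_pi (fun n => rexp (c * (2 * π) ^ 2) * rexp (-c * (n : ℝ) ^ 2))
    (fun n => by positivity) ((summ_one c hc).mul_left _) a
  refine ⟨_, hs, fun k z hz => (h _).trans ?_⟩
  rw [Finset.mul_sum, Real.exp_sum]
  refine Finset.prod_le_prod (fun i _ => (Real.exp_pos _).le) fun i _ => ?_
  rw [← Real.exp_add]
  apply Real.exp_le_exp.2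
  have h1 : 0 ≤ z i := hz.1 i
  have h2 : z i ≤ 2 * π := hz.2 i
  have h3 : (k i : ℝ) ^ 2 - (2 * π) ^ 2 ≤ sh z k i ^ 2 := by
    simp only [sh]
    have hp := Real.pi_gt_three
    have h4 : (z i) ^ 2 ≤ (2 * π) ^ 2 := by gcongr
    have h5 : (2 * π * k i) ^ 2 ≤ 2 * (z i + 2 * π * k i) ^ 2 + 2 * (z i) ^ 2 := by
      nlinarith [sq_nonneg (z i + 2 * π * k i + z i)]
    have h6 : 2 * (k i : ℝ) ^ 2 ≤ (2 * π * k i) ^ 2 := by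
      have : 2 ≤ (2 * π) ^ 2 := by nlinarith
      rw [mul_pow (2 * π)]
      gcongr
    linarith
  nlinarith

lemma orth_one (m : ℤ) : ∫ x in Set.Icc (0 : ℝ) (2 * π), Complex.exp (Complex.I * (m * x))
    = if m = 0 then (2 * π : ℂ) else 0 := by
  rw [integral_Icc_eq_integral_Ioc, ← intervalIntegral.integral_of_le (by positivity)]
  split_ifs with h
  · simp [h]
  · have hm : Complex.I * (m : ℂ) ≠ 0 := by simp [h]
    simp_rw [← mul_assoc]
    rw [integral_exp_mul_complex hm]
    have : Complex.exp (Complex.I * m * ((2 * π : ℝ) : ℂ)) = 1 := by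
      rw [Complex.exp_eq_one_iff]
      exact ⟨m, by push_cast; ring⟩
    rw [this]
    simp

lemma orth {a : ℕ} (k l : Fin a → ℤ) :
    ∫ ζ in Set.Icc (0 : Fin a → ℝ) (fun _ => 2 * π), ef k ζ * (starRingEnd ℂ) (ef l ζ)
      = if k = l then (2 * π : ℂ) ^ a else 0 := by
  have h1 : ∀ ζ : Fin a → ℝ, ef k ζ * (starRingEnd ℂ) (ef l ζ)
      = ∏ i, Complex.exp (Complex.I * ((k i - l i : ℤ) * (ζ i : ℂ))) := by
    intro ζ
    rw [ef, ef, ← Complex.exp_conj, ← Complex.exp_add, ← Complex.exp_sum]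
    congr 1
    simp only [map_mul, map_sum, Complex.conj_I, Complex.conj_ofReal, map_intCast]
    rw [← Finset.mul_sum, neg_mul, ← sub_eq_add_neg, ← mul_sub, ← Finset.sum_sub_distrib]
    congr 1
    refine Finset.sum_congr rfl fun i _ => ?_
    push_cast; ring
  simp_rw [h1]
  rw [← Set.pi_univ_Icc, volume_pi, Measure.restrict_pi_pi]
  rw [integral_fintype_prod_eq_prod (fun i (x : ℝ) =>
    Complex.exp (Complex.I * ((k i - l i : ℤ) * (x : ℂ))))]
  simp only [Pi.zero_apply, orth_one]
  split_ifs with h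
  · simp [h]
  · obtain ⟨i, hi⟩ := Function.ne_iff.1 h
    exact Finset.prod_eq_zero (Finset.mem_univ i) (by simp [sub_eq_zero, hi])

lemma unfold_sum {a : ℕ} (G : (Fin a → ℝ) → ℂ) (hG : Integrable G) :
    HasSum (fun k : Fin a → ℤ => ∫ z in Set.Icc (0 : Fin a → ℝ) (fun _ => 2 * π), G (sh z k))
      (∫ z, G z) := by
  set S : (Fin a → ℤ) → Set (Fin a → ℝ) := fun k =>
    Set.pi Set.univ fun i => Set.Ico (2 * π * k i) (2 * π * k i + 2 * π) with hS
  have hp : 0 < 2 * π := by positivity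
  have hm : ∀ k, MeasurableSet (S k) := fun k =>
    MeasurableSet.univ_pi fun i => measurableSet_Ico
  have hfl : ∀ (x : ℝ) (n : ℤ), x ∈ Set.Ico (2 * π * n) (2 * π * n + 2 * π) ↔
      ⌊x / (2 * π)⌋ = n := by
    intro x n
    rw [Int.floor_eq_iff, le_div_iff₀ hp, div_lt_iff₀ hp, Set.mem_Ico]
    constructor <;> rintro ⟨h1, h2⟩ <;> constructor <;> nlinarith
  have hmem : ∀ k x, x ∈ S k ↔ (fun i => ⌊x i / (2 * π)⌋) = k := by
    intro k x
    simp only [hS, Set.mem_univ_pi, hfl, funext_iff]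
  have hd : Pairwise (Function.onFun Disjoint S) := by
    intro k l hkl
    rw [Function.onFun, Set.disjoint_left]
    intro x hx hx'
    rw [hmem] at hx hx'
    exact hkl (hx.symm.trans hx')
  have hU : ⋃ k, S k = Set.univ := by
    ext x
    simp [hmem]
  have h := hasSum_integral_iUnion (μ := volume) (f := G) hm hd (by rw [hU]; exact hG.integrableOn)
  rw [hU, setIntegral_univ] at h
  suffices hfe : (fun k : Fin a → ℤ => ∫ z in Set.Icc (0 : Fin a → ℝ) (fun _ => 2 * π), G (sh z k))
      = fun k => ∫ x in S k, G x by
    rw [hfe]; exact h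
  funext k
  rw [← (measurePreserving_add_right volume (fun i => 2 * π * (k i : ℝ))).setIntegral_preimage_emb
    (measurableEmbedding_addRight _) G (S k)]
  have e : (fun x : Fin a → ℝ => x + fun i => 2 * π * (k i : ℝ)) ⁻¹' S k
      = Set.pi Set.univ fun i => Set.Ico ((0 : Fin a → ℝ) i) ((fun _ => 2 * π : Fin a → ℝ) i) := by
    ext x
    simp only [hS, Set.mem_preimage, Set.mem_univ_pi, Pi.add_apply, Set.mem_Ico, Pi.zero_apply]
    refine forall_congr' fun i => ?_
    constructor <;> rintro ⟨h1, h2⟩ <;> constructor <;> linarith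
  rw [e]
  exact (setIntegral_congr_set (Measure.univ_pi_Ico_ae_eq_Icc (μ := fun _ : Fin a => volume))).symm

lemma unfold_main {a : ℕ} (T₁ T₂ : Matrix (Fin a) (Fin a) ℂ)
    (hneg₁ : (-(T₁.map Complex.re)).PosDef) (hneg₂ : (-(T₂.map Complex.re)).PosDef) :
    (∫ p in Set.Icc ((0, 0) : (Fin a → ℝ) × (Fin a → ℝ)) ((fun _ => 2 * π), (fun _ => 2 * π)),
          theta T₁ p.1 p.2 * (starRingEnd ℂ) (theta T₂ p.1 p.2))
      = (2 * π : ℂ) ^ a * ∫ z : Fin a → ℝ, qf T₁ z * (starRingEnd ℂ) (qf T₂ z) := by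
  obtain ⟨u, hu, hu'⟩ := qf_unif T₁ hneg₁
  obtain ⟨v, hv, hv'⟩ := qf_unif T₂ hneg₂
  set Q : Set (Fin a → ℝ) := Set.Icc 0 (fun _ => 2 * π) with hQ
  have hQQ : Set.Icc ((0, 0) : (Fin a → ℝ) × (Fin a → ℝ)) ((fun _ => 2 * π), (fun _ => 2 * π))
      = Q ×ˢ Q := (Set.Icc_prod_Icc _ _ _ _).symm
  rw [hQQ]
  have hQm : MeasurableSet (Q ×ˢ Q) := measurableSet_Icc.prod measurableSet_Icc
  set F : (Fin a → ℤ) × (Fin a → ℤ) → (Fin a → ℝ) × (Fin a → ℝ) → ℂ := fun kl p =>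
    (qf T₁ (sh p.1 kl.1) * (starRingEnd ℂ) (qf T₂ (sh p.1 kl.2))) *
      (ef kl.1 p.2 * (starRingEnd ℂ) (ef kl.2 p.2)) with hF
  have hu0 : ∀ k, 0 ≤ u k := fun k =>
    (norm_nonneg _).trans (hu' k 0 ⟨le_rfl, fun _ => by positivity⟩)
  have hv0 : ∀ k, 0 ≤ v k := fun k =>
    (norm_nonneg _).trans (hv' k 0 ⟨le_rfl, fun _ => by positivity⟩)
  have hFn : ∀ kl, ∀ p ∈ Q ×ˢ Q, ‖F kl p‖ ≤ u kl.1 * v kl.2 := by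
    intro kl p hp
    simp only [hF, norm_mul, RCLike.norm_conj, ef_norm, mul_one]
    exact mul_le_mul (hu' _ _ hp.1) (hv' _ _ hp.1) (norm_nonneg _) (hu0 _)
  have h1 : ∀ p ∈ Q ×ˢ Q, theta T₁ p.1 p.2 * (starRingEnd ℂ) (theta T₂ p.1 p.2)
      = ∑' kl, F kl p := by
    intro p hp
    have s1 : Summable fun k => ‖qf T₁ (sh p.1 k) * ef k p.2‖ := by
      refine hu.of_nonneg_of_le (fun _ => norm_nonneg _) fun k => ?_
      rw [norm_mul, ef_norm, mul_one]
      exact hu' k _ hp.1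
    have s2 : Summable fun k => ‖(starRingEnd ℂ) (qf T₂ (sh p.1 k) * ef k p.2)‖ := by
      refine hv.of_nonneg_of_le (fun _ => norm_nonneg _) fun k => ?_
      rw [RCLike.norm_conj, norm_mul, ef_norm, mul_one]
      exact hv' k _ hp.1
    rw [theta_eq, theta_eq, Complex.conj_tsum, tsum_mul_tsum_of_summable_norm s1 s2]
    refine tsum_congr fun kl => ?_
    simp only [hF, map_mul]
    ring
  rw [setIntegral_congr_fun hQm h1]
  have hFc : ∀ kl, Continuous (F kl) := by
    intro kl
    have c1 : Continuous fun p : (Fin a → ℝ) × (Fin a → ℝ) => qf T₁ (sh p.1 kl.1) :=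
      (qf_cont T₁).comp ((sh_cont kl.1).comp continuous_fst)
    have c2 : Continuous fun p : (Fin a → ℝ) × (Fin a → ℝ) => qf T₂ (sh p.1 kl.2) :=
      (qf_cont T₂).comp ((sh_cont kl.2).comp continuous_fst)
    have c3 : Continuous fun p : (Fin a → ℝ) × (Fin a → ℝ) => ef kl.1 p.2 :=
      (ef_cont _).comp continuous_snd
    have c4 : Continuous fun p : (Fin a → ℝ) × (Fin a → ℝ) => ef kl.2 p.2 :=
      (ef_cont _).comp continuous_snd
    exact (c1.mul (Complex.continuous_conj.comp c2)).mul (c3.mul (Complex.continuous_conj.comp c4))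
  have hcomp : IsCompact (Q ×ˢ Q) := isCompact_Icc.prod isCompact_Icc
  have hFi : ∀ kl, IntegrableOn (F kl) (Q ×ˢ Q) := fun kl =>
    (hFc kl).continuousOn.integrableOn_compact hcomp
  have hsum : Summable fun kl => ∫ p in Q ×ˢ Q, ‖F kl p‖ := by
    have := (Summable.mul_of_nonneg hu hv hu0 hv0).mul_right (volume.real (Q ×ˢ Q))
    refine this.of_nonneg_of_le (fun _ => integral_nonneg fun _ => norm_nonneg _) fun kl => ?_
    have h := norm_setIntegral_le_of_norm_le_const (μ := volume) (f := fun p => ‖F kl p‖)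
      hcomp.measure_lt_top (fun p hp => by rw [norm_norm]; exact hFn kl p hp)
    exact (le_abs_self _).trans h
  have hS := hasSum_integral_of_summable_integral_norm hFi hsum
  rw [← hS.tsum_eq]
  have hval : ∀ kl, ∫ p in Q ×ˢ Q, F kl p
      = (∫ z in Q, qf T₁ (sh z kl.1) * (starRingEnd ℂ) (qf T₂ (sh z kl.2))) *
        (if kl.1 = kl.2 then (2 * π : ℂ) ^ a else 0) := by
    intro kl
    rw [← orth kl.1 kl.2, ← setIntegral_prod_mul, ← Measure.volume_eq_prod]
  simp_rw [hval]
  have hinj : Function.Injective (fun k : Fin a → ℤ => (k, k)) := fun k l h => (Prod.ext_iff.1 h).1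
  rw [← hinj.tsum_eq]
  · simp only [if_true]
    rw [tsum_mul_right, mul_comm]
    congr 1
    refine (unfold_sum (fun w => qf T₁ w * (starRingEnd ℂ) (qf T₂ w)) ?_).tsum_eq
    obtain ⟨c, hc, hb⟩ := qf_bound T₁ hneg₁
    obtain ⟨c', hc', hb'⟩ := qf_bound T₂ hneg₂
    have hi : Integrable fun w : Fin a → ℝ => ∏ i, rexp (-c * w i ^ 2) :=
      Integrable.fintype_prod (f := fun _ x => rexp (-c * x ^ 2))
        fun i => integrable_exp_neg_mul_sq hc
    refine hi.mono' ((qf_cont T₁).mul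
      (Complex.continuous_conj.comp (qf_cont T₂))).aestronglyMeasurable ?_
    refine Filter.Eventually.of_forall fun w => ?_
    rw [norm_mul, RCLike.norm_conj, ← Real.exp_sum, ← Finset.mul_sum]
    have : ‖qf T₂ w‖ ≤ 1 := (hb' w).trans (by
      apply Real.exp_le_one_iff.2
      have : 0 ≤ ∑ i, w i ^ 2 := by positivity
      nlinarith)
    calc _ ≤ ‖qf T₁ w‖ * 1 := by gcongr
      _ ≤ _ := by rw [mul_one]; exact hb w
  · intro kl hkl
    rw [Function.mem_support] at hkl
    by_cases h : kl.1 = kl.2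
    · exact ⟨kl.1, Prod.ext rfl h⟩
    · simp [h] at hkl

lemma qf_mul {a : ℕ} (T₁ T₂ : Matrix (Fin a) (Fin a) ℂ) (z : Fin a → ℝ) :
    qf T₁ z * (starRingEnd ℂ) (qf T₂ z) = qf (T₁ + T₂.map (starRingEnd ℂ)) z := by
  rw [qf, qf, qf, ← Complex.exp_conj, ← Complex.exp_add]
  congr 1
  rw [add_mulVec, dotProduct_add, mul_add]
  congr 1
  simp [dotProduct, mulVec, cv, Complex.conj_ofNat]

/-- the inner product of two theta-functions over `[0,2π]^{2a}`
is a Gaussian integral, evaluating to `(2π)^{a/2} μ` with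
`μ² = det(−T₁ − conj(T₂))⁻¹`. -/
theorem theta_inner_product (a : ℕ)
    (T₁ T₂ : Matrix (Fin a) (Fin a) ℂ)
    (hsym₁ : T₁ᵀ = T₁) (hsym₂ : T₂ᵀ = T₂)
    (hneg₁ : (-(T₁.map Complex.re)).PosDef) (hneg₂ : (-(T₂.map Complex.re)).PosDef) :
    (1 / (2 * π : ℂ) ^ a) *
        (∫ p in Set.Icc ((0, 0) : (Fin a → ℝ) × (Fin a → ℝ))
            ((fun _ => 2 * π), (fun _ => 2 * π)),
          theta T₁ p.1 p.2 * (starRingEnd ℂ) (theta T₂ p.1 p.2))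
      = (∫ z : Fin a → ℝ,
          Complex.exp ((1 / 2 : ℂ) *
            dotProduct (cv z) (((T₁ + T₂.map (starRingEnd ℂ)).mulVec (cv z))))) ∧
    ∃ μ : ℂ, μ ^ 2 = ((-(T₁ + T₂.map (starRingEnd ℂ))).det)⁻¹ ∧
      (1 / (2 * π : ℂ) ^ a) *
          (∫ p in Set.Icc ((0, 0) : (Fin a → ℝ) × (Fin a → ℝ))
              ((fun _ => 2 * π), (fun _ => 2 * π)),
            theta T₁ p.1 p.2 * (starRingEnd ℂ) (theta T₂ p.1 p.2))
        = (((2 * π) ^ ((a : ℝ) / 2) : ℝ) : ℂ) * μ := by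
  have hN : (-((T₁ + T₂.map (starRingEnd ℂ)).map Complex.re)).PosDef := by
    have e : -((T₁ + T₂.map (starRingEnd ℂ)).map Complex.re)
        = -(T₁.map Complex.re) + -(T₂.map Complex.re) := by
      ext i j
      simp
      ring
    rw [e]
    exact hneg₁.add hneg₂
  have hs : (T₁ + T₂.map (starRingEnd ℂ))ᵀ = T₁ + T₂.map (starRingEnd ℂ) := by
    rw [transpose_add, ← transpose_map, hsym₁, hsym₂]
  have hpi : (2 * π : ℂ) ^ a ≠ 0 := by
    apply pow_ne_zero
    exact_mod_cast Real.two_pi_pos.ne'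
  have key : (1 / (2 * π : ℂ) ^ a) *
        (∫ p in Set.Icc ((0, 0) : (Fin a → ℝ) × (Fin a → ℝ))
            ((fun _ => 2 * π), (fun _ => 2 * π)),
          theta T₁ p.1 p.2 * (starRingEnd ℂ) (theta T₂ p.1 p.2))
      = (∫ z : Fin a → ℝ,
          Complex.exp ((1 / 2 : ℂ) *
            dotProduct (cv z) (((T₁ + T₂.map (starRingEnd ℂ)).mulVec (cv z))))) := by
    rw [unfold_main T₁ T₂ hneg₁ hneg₂, ← mul_assoc, one_div, inv_mul_cancel₀ hpi, one_mul]
    simp_rw [qf_mul]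
    rfl
  refine ⟨key, ?_⟩
  obtain ⟨μ, h1, h2⟩ := gauss _ hs hN
  exact ⟨μ, h1, key.trans h2⟩
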